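/- Let (w,v,u) ∈ Q with ℓ(w) + ℓ(u) − ℓ(v) = 1. Then there are exactly two triples (w',v',u') ∈ Q with (w',v',u') <_Q (w,v,u). -/

import Mathlib

/-!
Common definitions: Bruhat order, standard parabolic subgroups, minimal coset
representatives, the J-Bruhat (twisted) order and J-length, chains and
EL-labeling machinery, for a Coxeter system `cs : CoxeterSystem M W`.
-/

open scoped Classical

namespace TwistedTP

/-- A chain (list) realizing consecutive `r`-steps starting at `a` and ending at `b`. -/
def IsChainFrom {α : Type*} (r : α → α → Prop) (c : List α) (a b : α) : Prop :=
  c.head? = some a ∧ c.getLast? = some b ∧ c.Chain' r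

/-- The word of labels attached to the consecutive pairs of a list.
For a list `z₀ :: z₁ :: ⋯` (written from top to bottom in a descending chain),
the entries are `lab z₁ z₀, lab z₂ z₁, …`, i.e. `lab` is applied to each
covering pair `(lower, upper)`. -/
def labelWord {α Λ : Type*} (lab : α → α → Λ) : List α → List Λ
  | a :: b :: rest => lab b a :: labelWord lab (b :: rest)
  | _ => []

variable {B : Type*} {W : Type*} [Group W] {M : CoxeterMatrix B}
variable (cs : CoxeterSystem M W)

/-- The (strong) Bruhat order on `W`: `v ≤ w` iff some reduced word for `w`
has a sublist whose product is `v`. -/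
def bruhatLE (v w : W) : Prop :=
  ∃ ω : List B, cs.IsReduced ω ∧ cs.wordProd ω = w ∧
    ∃ ω' : List B, ω'.Sublist ω ∧ cs.wordProd ω' = v

def bruhatLT (v w : W) : Prop := bruhatLE cs v w ∧ v ≠ w

def bruhatCovBy (v w : W) : Prop :=
  bruhatLT cs v w ∧ ¬ ∃ z, bruhatLT cs v z ∧ bruhatLT cs z w

/-- The standard parabolic subgroup `W_J`. -/
def parabolic (J : Set B) : Subgroup W := Subgroup.closure (cs.simple '' J)

lemma exists_minRep (J : Set B) (w : W) :
    ∃ u : W, u⁻¹ * w ∈ parabolic cs J ∧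
      ∀ x : W, x⁻¹ * w ∈ parabolic cs J → cs.length u ≤ cs.length x := by
  have hne : (cs.length '' {x : W | x⁻¹ * w ∈ parabolic cs J}).Nonempty :=
    ⟨cs.length w, w, by simpa using (parabolic cs J).one_mem, rfl⟩
  obtain ⟨n, hn, hmin⟩ := Nat.lt_wfRel.wf.has_min _ hne
  obtain ⟨u, hu, rfl⟩ := hn
  refine ⟨u, hu, fun x hx => ?_⟩
  by_contra h
  exact hmin _ ⟨x, hx, rfl⟩ (Nat.lt_of_not_le h)

/-- The minimal-length representative `w^J` of the coset `w W_J`. -/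
noncomputable def minRep (J : Set B) (w : W) : W := (exists_minRep cs J w).choose

/-- The parabolic part `w_J = (w^J)⁻¹ w ∈ W_J` of `w`. -/
noncomputable def parPart (J : Set B) (w : W) : W := (minRep cs J w)⁻¹ * w

/-- The J-Bruhat (twisted) order `≤^J` on `W`:
`v ≤^J w` iff there is `u ∈ W_J` with `v^J u ≤ w^J` and `w_J ≤ u⁻¹ v_J`. -/
def twistedLE (J : Set B) (v w : W) : Prop :=
  ∃ u ∈ parabolic cs J,
    bruhatLE cs (minRep cs J v * u) (minRep cs J w) ∧
    bruhatLE cs (parPart cs J w) (u⁻¹ * parPart cs J v)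

def twistedLT (J : Set B) (v w : W) : Prop := twistedLE cs J v w ∧ v ≠ w

def twistedCovBy (J : Set B) (v w : W) : Prop :=
  twistedLT cs J v w ∧ ¬ ∃ z, twistedLT cs J v z ∧ twistedLT cs J z w

/-- The J-length `ℓ^J(w) = ℓ(w^J) - ℓ(w_J)` (an integer). -/
noncomputable def twistedLength (J : Set B) (w : W) : ℤ :=
  (cs.length (minRep cs J w) : ℤ) - (cs.length (parPart cs J w) : ℤ)



/-- Membership in `Q`: triples `(w, v, u)` such that `w ∘_l v ≤ u`, i.e. there is
`w' ≤ w` with `w' v ≤ u`. -/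
def Qmem (t : W × W × W) : Prop :=
  ∃ w' : W, bruhatLE cs w' t.1 ∧ bruhatLE cs (w' * t.2.1) t.2.2

/-- The order on `Q`: `(w',v',u') ≤_Q (w,v,u)` iff `w' ≤ w`, `v ≤ v'` and `u' ≤ u`. -/
def qqle (a b : W × W × W) : Prop :=
  bruhatLE cs a.1 b.1 ∧ bruhatLE cs b.2.1 a.2.1 ∧ bruhatLE cs a.2.2 b.2.2

def qqlt (a b : W × W × W) : Prop := qqle cs a b ∧ a ≠ b

lemma bruhatLE_inv {v w : W} (h : bruhatLE cs v w) : bruhatLE cs v⁻¹ w⁻¹ := by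
  obtain ⟨ω, hω, rfl, ω', hs, rfl⟩ := h
  exact ⟨ω.reverse, hω.reverse, by simp, ω'.reverse, hs.reverse, by simp⟩

lemma bruhatLE_inv_iff {v w : W} : bruhatLE cs v⁻¹ w⁻¹ ↔ bruhatLE cs v w :=
  ⟨fun h => by simpa using bruhatLE_inv cs h, bruhatLE_inv cs⟩

lemma bruhatLE_refl (w : W) : bruhatLE cs w w := by
  obtain ⟨ω, hω, rfl⟩ := cs.exists_isReduced w
  exact ⟨ω, hω, rfl, ω, List.Sublist.refl _, rfl⟩

lemma length_le_of_bruhatLE {v w : W} (h : bruhatLE cs v w) : cs.length v ≤ cs.length w := by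
  obtain ⟨ω, hω, rfl, ω', hs, rfl⟩ := h
  exact (cs.length_wordProd_le ω').trans (hs.length_le.trans_eq hω.eq.symm)

lemma eq_of_bruhatLE_of_length_le {v w : W} (h : bruhatLE cs v w)
    (hl : cs.length w ≤ cs.length v) : v = w := by
  obtain ⟨ω, hω, rfl, ω', hs, rfl⟩ := h
  rw [hs.eq_of_length_le (hω.eq.symm.le.trans (hl.trans (cs.length_wordProd_le ω')))]

lemma exists_eraseIdx_of_sublist {α : Type*} {l' l : List α} (h : l'.Sublist l)
    (hl : l'.length + 1 = l.length) : ∃ i < l.length, l' = l.eraseIdx i := by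
  induction h with
  | slnil => simp at hl
  | cons a h ih => exact ⟨0, by simp, h.eq_of_length (by simpa using hl)⟩
  | cons_cons a h ih =>
    obtain ⟨i, hi, rfl⟩ := ih (by simpa using hl)
    exact ⟨i + 1, by simpa using hi, by simp⟩

lemma exists_eraseIdx_of_bruhatLE {v w : W} (h : bruhatLE cs v w)
    (hl : cs.length w = cs.length v + 1) :
    ∃ ω : List B, cs.IsReduced ω ∧ cs.wordProd ω = w ∧
      ∃ i < ω.length, cs.wordProd (ω.eraseIdx i) = v := by
  obtain ⟨ω, hω, rfl, ω', hs, rfl⟩ := h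
  have hne : ω'.length ≠ ω.length := fun he => by
    rw [hs.eq_of_length he] at hl
    omega
  have h1 := cs.length_wordProd_le ω'
  have h2 := hs.length_le
  have h3 := hω.eq
  obtain ⟨i, hi, rfl⟩ := exists_eraseIdx_of_sublist hs (by omega)
  exact ⟨ω, hω, rfl, i, hi, rfl⟩

/-- Conjugation by a simple reflection on `W × ℤ/2`, flipping the sign at that reflection. -/
noncomputable def signedConj (i : B) : Function.End (W × ZMod 2) := fun p =>
  (cs.simple i * p.1 * cs.simple i, p.2 + if p.1 = cs.simple i then 1 else 0)

lemma prod_map_signedConj_apply (ω : List B) (p : W × ZMod 2) :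
    (ω.map (signedConj cs)).prod p =
      (cs.wordProd ω * p.1 * (cs.wordProd ω)⁻¹, p.2 + ((cs.rightInvSeq ω).count p.1 : ZMod 2)) := by
  induction ω with
  | nil => simp [Function.End.one_def]
  | cons i ω ih =>
    rw [List.map_cons, List.prod_cons]
    change signedConj cs i ((ω.map (signedConj cs)).prod p) = _
    rw [ih]
    have hiff : cs.wordProd ω * p.1 * (cs.wordProd ω)⁻¹ = cs.simple i ↔
        (cs.wordProd ω)⁻¹ * cs.simple i * cs.wordProd ω = p.1 := by
      constructor
      · intro h
        rw [← h]
        group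
      · intro h
        rw [← h]
        group
    simp only [signedConj, hiff, CoxeterSystem.rightInvSeq, List.count_cons, beq_iff_eq]
    simp [cs.wordProd_cons, mul_assoc, add_assoc]

lemma rightInvSeq_eq_leftInvSeq {ω : List B} (h : cs.wordProd ω = 1) :
    cs.rightInvSeq ω = cs.leftInvSeq ω := by
  refine List.ext_getElem (by simp) fun k h1 h2 => ?_
  have e1 := cs.wordProd_mul_getD_rightInvSeq ω k
  have e2 := cs.getD_leftInvSeq_mul_wordProd ω k
  rw [List.getD_eq_getElem _ _ h1, h, one_mul] at e1
  rw [List.getD_eq_getElem _ _ h2, h, mul_one] at e2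
  rw [e1, e2]

lemma wordProd_alternatingWord_two_mul_order (i j : B) :
    cs.wordProd (CoxeterSystem.alternatingWord i j (2 * M i j)) = 1 := by
  rw [cs.prod_alternatingWord_eq_mul_pow]
  simp

lemma even_count_rightInvSeq_alternatingWord (i j : B) (r : W) :
    Even ((cs.rightInvSeq (CoxeterSystem.alternatingWord i j (2 * M i j))).count r) := by
  rw [rightInvSeq_eq_leftInvSeq cs (wordProd_alternatingWord_two_mul_order cs i j)]
  set l := cs.leftInvSeq (CoxeterSystem.alternatingWord i j (2 * M i j)) with hl
  have hlen : l.length = 2 * M i j := by simp [hl]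
  have hper : l.drop (M i j) = l.take (M i j) := by
    refine List.ext_getElem (by simp [hlen]; omega) fun k h1 h2 => ?_
    have hk : k < M i j := by simp at h2; omega
    rw [List.getElem_drop, List.getElem_take]
    simp only [hl]
    rw [cs.getElem_leftInvSeq_alternatingWord i j _ _ (by omega),
      cs.getElem_leftInvSeq_alternatingWord i j _ _ (by omega),
      cs.prod_alternatingWord_eq_mul_pow, cs.prod_alternatingWord_eq_mul_pow,
      if_neg (by simp), if_neg (by simp),
      show (2 * (M i j + k) + 1) / 2 = M i j + k by omega,
      show (2 * k + 1) / 2 = k by omega, pow_add,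
      cs.simple_mul_simple_pow', one_mul]
  rw [← List.take_append_drop (M i j) l, hper, List.count_append]
  exact ⟨_, rfl⟩

lemma prod_map_alternatingWord {G : Type*} [Monoid G] (f : B → G) (i j : B) (m : ℕ) :
    ((CoxeterSystem.alternatingWord i j (2 * m)).map f).prod = (f i * f j) ^ m := by
  induction m with
  | zero => simp [CoxeterSystem.alternatingWord]
  | succ m ih =>
    rw [show 2 * (m + 1) = 2 * m + 1 + 1 by ring, CoxeterSystem.alternatingWord_succ,
      CoxeterSystem.alternatingWord_succ, pow_succ, ← ih]
    simp

lemma isLiftable_signedConj : M.IsLiftable (signedConj cs) := by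
  intro i j
  rw [← prod_map_alternatingWord]
  funext p
  rw [prod_map_signedConj_apply, wordProd_alternatingWord_two_mul_order,
    (ZMod.natCast_eq_zero_iff_even).2 (even_count_rightInvSeq_alternatingWord cs i j p.1)]
  simp [Function.End.one_def]

lemma lift_signedConj_wordProd (ω : List B) :
    cs.lift ⟨signedConj cs, isLiftable_signedConj cs⟩ (cs.wordProd ω) =
      (ω.map (signedConj cs)).prod := by
  simp [CoxeterSystem.wordProd, map_list_prod, Function.comp_def]

/-- The parity of the number of occurrences of `r` in the right inversion sequence of any word
for `w`. -/
noncomputable def inversionParity (w r : W) : ZMod 2 :=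
  (cs.lift ⟨signedConj cs, isLiftable_signedConj cs⟩ w (r, 0)).2

lemma inversionParity_wordProd (ω : List B) (r : W) :
    inversionParity cs (cs.wordProd ω) r = ((cs.rightInvSeq ω).count r : ZMod 2) := by
  rw [inversionParity, lift_signedConj_wordProd, prod_map_signedConj_apply, zero_add]

lemma inversionParity_mul (x y r : W) :
    inversionParity cs (x * y) r =
      inversionParity cs y r + inversionParity cs x (y * r * y⁻¹) := by
  obtain ⟨ω, rfl⟩ := cs.wordProd_surjective x
  obtain ⟨ω', rfl⟩ := cs.wordProd_surjective y
  rw [inversionParity_wordProd, inversionParity_wordProd, inversionParity, map_mul,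
    lift_signedConj_wordProd, lift_signedConj_wordProd]
  change ((ω.map (signedConj cs)).prod ((ω'.map (signedConj cs)).prod (r, 0))).2 = _
  rw [prod_map_signedConj_apply, prod_map_signedConj_apply, zero_add]

lemma inversionParity_reflection {t : W} (ht : cs.IsReflection t) :
    inversionParity cs t t = 1 := by
  obtain ⟨w, i, rfl⟩ := ht
  have h1 : inversionParity cs (w * w⁻¹) (w * cs.simple i * w⁻¹) = 0 := by
    simpa using inversionParity_wordProd cs [] (w * cs.simple i * w⁻¹)
  have hs : inversionParity cs (cs.simple i) (cs.simple i) = 1 := by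
    simpa using inversionParity_wordProd cs [i] (cs.simple i)
  have hc : w⁻¹ * (w * cs.simple i * w⁻¹) * w⁻¹⁻¹ = cs.simple i := by group
  rw [inversionParity_mul, hc] at h1
  rw [inversionParity_mul, hc, inversionParity_mul, hs, cs.simple_mul_simple_self, one_mul,
    cs.inv_simple]
  linear_combination h1

/-- The strong exchange condition: a right inversion of `π ω` occurs in the right inversion
sequence of `ω`, whether or not `ω` is reduced. -/
lemma mem_rightInvSeq_of_isRightInversion {ω : List B} {t : W}
    (h : cs.IsRightInversion (cs.wordProd ω) t) : t ∈ cs.rightInvSeq ω := by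
  obtain ⟨ht, hlt⟩ := h
  by_contra hmem
  have h0 : inversionParity cs (cs.wordProd ω) t = 0 := by
    rw [inversionParity_wordProd, List.count_eq_zero_of_not_mem hmem, Nat.cast_zero]
  have h1 : inversionParity cs (cs.wordProd ω * t) t = 1 := by
    rw [inversionParity_mul, inversionParity_reflection cs ht, mul_inv_cancel_right, h0, add_zero]
  obtain ⟨ω', hω', he⟩ := cs.exists_isReduced (cs.wordProd ω * t)
  rw [he, inversionParity_wordProd] at h1
  have hmem' : t ∈ cs.rightInvSeq ω' := by
    by_contra hn
    rw [List.count_eq_zero_of_not_mem hn, Nat.cast_zero] at h1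
    exact zero_ne_one h1
  have h2 := (cs.isRightInversion_of_mem_rightInvSeq hω' hmem').2
  rw [← he, mul_assoc, ht.mul_self, mul_one] at h2
  omega

/-- The strong exchange condition on the left, in terms of deleting a letter. -/
lemma exists_eraseIdx_of_isLeftInversion {ω : List B} {t : W}
    (h : cs.IsLeftInversion (cs.wordProd ω) t) :
    ∃ j < ω.length, cs.wordProd (ω.eraseIdx j) = t * cs.wordProd ω := by
  have hmem : t ∈ cs.leftInvSeq ω := by
    have := mem_rightInvSeq_of_isRightInversion cs (ω := ω.reverse) (t := t)
      (by rwa [cs.wordProd_reverse, cs.isRightInversion_inv_iff])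
    rwa [cs.rightInvSeq_reverse, List.mem_reverse] at this
  obtain ⟨j, hj, rfl⟩ := List.mem_iff_getElem.1 hmem
  refine ⟨j, by simpa using hj, ?_⟩
  rw [← cs.getD_leftInvSeq_mul_wordProd, List.getD_eq_getElem _ _ hj]

lemma eraseIdx_inj_of_isReduced {ω : List B} (hω : cs.IsReduced ω) {i j : ℕ} (hi : i < ω.length)
    (hj : j < ω.length) (h : cs.wordProd (ω.eraseIdx i) = cs.wordProd (ω.eraseIdx j)) : i = j := by
  rw [← cs.getD_leftInvSeq_mul_wordProd, ← cs.getD_leftInvSeq_mul_wordProd, mul_left_inj,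
    List.getD_eq_getElem _ _ (by simpa using hi), List.getD_eq_getElem _ _ (by simpa using hj)] at h
  exact (hω.nodup_leftInvSeq).getElem_inj_iff.1 h

lemma length_eq_of_bruhatLE_mul_inv {x v u : W}
    (hlen : cs.length x + cs.length u = cs.length v + 1) (h : bruhatLE cs (v * u⁻¹) x) :
    cs.length x = cs.length (v * u⁻¹) + 1 := by
  have h1 := length_le_of_bruhatLE cs h
  have h2 := cs.length_mul_mod_two v u⁻¹
  have h3 := cs.length_le_length_mul_add_right v u⁻¹
  rw [cs.length_inv] at h2 h3
  omega

lemma length_eq_of_bruhatLE_inv_mul {x v u : W}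
    (hlen : cs.length x + cs.length u = cs.length v + 1) (h : bruhatLE cs (x⁻¹ * v) u) :
    cs.length u = cs.length (x⁻¹ * v) + 1 := by
  have h1 := length_le_of_bruhatLE cs h
  have h2 := cs.length_mul_mod_two x⁻¹ v
  have h3 := cs.length_le_length_mul_add_left x⁻¹ v
  rw [cs.length_inv] at h2 h3
  omega

/-- If `v` arises by deleting a letter of `x` from a concatenation of reduced words for `x` and `u`,
and that concatenation is not reduced, then `v` also arises by deleting a letter of `u`. -/
lemma bruhatLE_of_not_bruhatLE_mul {x v u : W}
    (hlen : cs.length x + cs.length u = cs.length v + 1) (hA : bruhatLE cs (v * u⁻¹) x)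
    (hC : ¬ bruhatLE cs v (x * u)) : bruhatLE cs (x⁻¹ * v) u := by
  obtain ⟨a, ha, rfl, i, hi, hai⟩ :=
    exists_eraseIdx_of_bruhatLE cs hA (length_eq_of_bruhatLE_mul_inv cs hlen hA)
  obtain ⟨b, hb, rfl⟩ := cs.exists_isReduced u
  have hprod : cs.wordProd (a.eraseIdx i ++ b) = v := by
    rw [cs.wordProd_append, hai, inv_mul_cancel_right]
  have hnred : ¬ cs.IsReduced (a ++ b) := fun hred =>
    hC ⟨a ++ b, hred, cs.wordProd_append a b, a.eraseIdx i ++ b,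
      (List.eraseIdx_sublist a i).append_right b, hprod⟩
  have hlt : cs.length (cs.wordProd a * cs.wordProd b) < cs.length v := by
    have h1 := cs.length_wordProd_le (a ++ b)
    have h2 := cs.length_mul_mod_two (cs.wordProd a) (cs.wordProd b)
    have h3 := ha.eq
    have h4 := hb.eq
    rw [CoxeterSystem.IsReduced] at hnred
    rw [cs.wordProd_append] at h1 hnred
    rw [List.length_append] at h1 hnred
    omega
  set t := (cs.leftInvSeq a).getD i 1 with ht
  have htx : t * cs.wordProd a = v * (cs.wordProd b)⁻¹ := by
    rw [ht, cs.getD_leftInvSeq_mul_wordProd, hai]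
  have htt : t * t = 1 := cs.getD_leftInvSeq_mul_self a i
  have htv : t * v = cs.wordProd a * cs.wordProd b := by
    rw [← inv_mul_cancel_right v (cs.wordProd b), ← htx, ← mul_assoc, ← mul_assoc, htt, one_mul]
  have htr : cs.IsReflection t := by
    refine cs.isReflection_of_mem_leftInvSeq a ?_
    rw [ht, List.getD_eq_getElem _ _ (by simpa using hi)]
    exact List.getElem_mem _
  obtain ⟨j, hj, hje⟩ := exists_eraseIdx_of_isLeftInversion cs
    (ω := a.eraseIdx i ++ b) (t := t) ⟨htr, by rwa [hprod, htv]⟩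
  rw [hprod, htv] at hje
  by_cases hji : j < (a.eraseIdx i).length
  · rw [List.eraseIdx_append_of_lt_length hji, cs.wordProd_append, mul_left_inj] at hje
    have h1 := cs.length_wordProd_le ((a.eraseIdx i).eraseIdx j)
    rw [hje, ha.eq, List.length_eraseIdx_of_lt hji, List.length_eraseIdx_of_lt hi] at h1
    omega
  · rw [List.eraseIdx_append_of_length_le (by omega), cs.wordProd_append, hai] at hje
    refine ⟨b, hb, rfl, _, List.eraseIdx_sublist b (j - (a.eraseIdx i).length), ?_⟩
    rw [← htx, ← htv, mul_assoc] at hje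
    rw [← mul_left_cancel hje, inv_mul_cancel_left]

/-- If a concatenation of reduced words for `x` and `u` is reduced, then `v` cannot arise from it
both by deleting a letter of `x` and by deleting a letter of `u`. -/
lemma not_bruhatLE_and_bruhatLE {x v u : W}
    (hlen : cs.length x + cs.length u = cs.length v + 1) (hC : bruhatLE cs v (x * u))
    (hA : bruhatLE cs (v * u⁻¹) x) : ¬ bruhatLE cs (x⁻¹ * v) u := by
  intro hB
  obtain ⟨a, ha, rfl, i, hi, hai⟩ :=
    exists_eraseIdx_of_bruhatLE cs hA (length_eq_of_bruhatLE_mul_inv cs hlen hA)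
  obtain ⟨b, hb, rfl, j, hj, hbj⟩ :=
    exists_eraseIdx_of_bruhatLE cs hB (length_eq_of_bruhatLE_inv_mul cs hlen hB)
  have hred : cs.IsReduced (a ++ b) := by
    have h1 := length_le_of_bruhatLE cs hC
    have h2 := cs.length_wordProd_le (a ++ b)
    have h3 := cs.length_mul_mod_two (cs.wordProd a) (cs.wordProd b)
    have h4 := ha.eq
    have h5 := hb.eq
    rw [CoxeterSystem.IsReduced]
    rw [cs.wordProd_append] at h2 ⊢
    rw [List.length_append] at h2 ⊢
    omega
  have hij : i = a.length + j := by
    refine eraseIdx_inj_of_isReduced cs hred (by simp; omega) (by simpa using hj) ?_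
    rw [List.eraseIdx_append_of_lt_length hi, List.eraseIdx_append_of_length_le (by omega),
      Nat.add_sub_cancel_left, cs.wordProd_append, cs.wordProd_append, hai, hbj]
    group
  omega

lemma length_add_length_of_Qmem {w v u : W} (h : Qmem cs (w, v, u)) :
    cs.length v ≤ cs.length w + cs.length u := by
  obtain ⟨z, hz, hzu⟩ := h
  have h1 := length_le_of_bruhatLE cs hz
  have h2 := length_le_of_bruhatLE cs hzu
  have h3 := cs.length_le_length_mul_add_left z v
  dsimp only at h1 h2
  omega

lemma mul_eq_of_Qmem {w v u : W} (h : Qmem cs (w, v, u))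
    (hlen : cs.length w + cs.length u ≤ cs.length v) : w * v = u := by
  obtain ⟨z, hz, hzu⟩ := h
  dsimp only at hz hzu
  have h1 := length_le_of_bruhatLE cs hz
  have h2 := length_le_of_bruhatLE cs hzu
  have h3 := cs.length_le_length_mul_add_left z v
  obtain rfl := eq_of_bruhatLE_of_length_le cs hz (by omega)
  exact eq_of_bruhatLE_of_length_le cs hzu (by omega)

lemma bruhatLE_or_bruhatLE_of_Qmem {w v u : W} (h : Qmem cs (w, v, u))
    (hlen : cs.length w + cs.length u = cs.length v + 1) :
    bruhatLE cs (u * v⁻¹) w ∨ bruhatLE cs (w * v) u := by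
  obtain ⟨z, hz, hzu⟩ := h
  dsimp only at hz hzu
  by_cases hzw : cs.length w ≤ cs.length z
  · obtain rfl := eq_of_bruhatLE_of_length_le cs hz hzw
    exact Or.inr hzu
  · have h3 := cs.length_le_length_mul_add_left z v
    rw [← eq_of_bruhatLE_of_length_le cs hzu (by omega), mul_inv_cancel_right]
    exact Or.inl hz

lemma Qmem_of_mul_eq {w v u : W} (h : w * v = u) : Qmem cs (w, v, u) :=
  ⟨w, bruhatLE_refl cs w, h ▸ bruhatLE_refl cs _⟩

/-- The elements of `Q` strictly below a triple of rank one. -/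
lemma Qmem_and_qqlt_iff {w v u : W} (hlen : cs.length w + cs.length u = cs.length v + 1)
    (t : W × W × W) :
    Qmem cs t ∧ qqlt cs t (w, v, u) ↔
      (bruhatLE cs (u * v⁻¹) w ∧ t = (u * v⁻¹, v, u)) ∨
      (bruhatLE cs (w * v) u ∧ t = (w, v, w * v)) ∨
      (bruhatLE cs v (w⁻¹ * u) ∧ t = (w, w⁻¹ * u, u)) := by
  have hne : w * v ≠ u := by
    rintro rfl
    have := cs.length_mul_mod_two w v
    omega
  constructor
  · obtain ⟨w', v', u'⟩ := t
    rintro ⟨hQ, ⟨hw, hv, hu⟩, hneq⟩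
    dsimp only at hw hv hu
    have h0 := length_add_length_of_Qmem cs hQ
    have h1 := length_le_of_bruhatLE cs hw
    have h2 := length_le_of_bruhatLE cs hv
    have h3 := length_le_of_bruhatLE cs hu
    by_cases e1 : cs.length w ≤ cs.length w'
    · obtain rfl := eq_of_bruhatLE_of_length_le cs hw e1
      by_cases e2 : cs.length v' ≤ cs.length v
      · obtain rfl := eq_of_bruhatLE_of_length_le cs hv e2
        by_cases e3 : cs.length u ≤ cs.length u'
        · obtain rfl := eq_of_bruhatLE_of_length_le cs hu e3
          exact absurd rfl hneq
        · obtain rfl := mul_eq_of_Qmem cs hQ (by omega)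
          exact Or.inr (Or.inl ⟨hu, rfl⟩)
      · obtain rfl := eq_of_bruhatLE_of_length_le cs hu (by omega)
        obtain rfl := eq_inv_mul_of_mul_eq (mul_eq_of_Qmem cs hQ (by omega))
        exact Or.inr (Or.inr ⟨hv, rfl⟩)
    · obtain rfl := eq_of_bruhatLE_of_length_le cs hv (by omega)
      obtain rfl := eq_of_bruhatLE_of_length_le cs hu (by omega)
      obtain rfl := eq_mul_inv_of_mul_eq (mul_eq_of_Qmem cs hQ (by omega))
      exact Or.inl ⟨hw, rfl⟩
  · rintro (⟨h, rfl⟩ | ⟨h, rfl⟩ | ⟨h, rfl⟩)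
    · refine ⟨Qmem_of_mul_eq cs (by simp), ⟨h, bruhatLE_refl cs _, bruhatLE_refl cs _⟩, fun he => ?_⟩
      exact hne (by simpa using (eq_mul_inv_iff_mul_eq.1 (congrArg Prod.fst he).symm))
    · refine ⟨Qmem_of_mul_eq cs rfl, ⟨bruhatLE_refl cs _, bruhatLE_refl cs _, h⟩, fun he => ?_⟩
      exact hne (by simpa using he)
    · refine ⟨Qmem_of_mul_eq cs (by simp), ⟨bruhatLE_refl cs _, h, bruhatLE_refl cs _⟩, fun he => ?_⟩
      have h1 : w⁻¹ * u = v := by simpa using he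
      exact hne (by rw [← h1]; simp)

/-- Let `(w, v, u) ∈ Q` with `ℓ(w) + ℓ(u) - ℓ(v) = 1`. Then there
are exactly two triples `(w', v', u') ∈ Q` with `(w', v', u') <_Q (w, v, u)`. -/
theorem Q_rank_one (w v u : W) (h : Qmem cs (w, v, u))
    (hlen : (cs.length w : ℤ) + (cs.length u : ℤ) - (cs.length v : ℤ) = 1) :
    {t : W × W × W | Qmem cs t ∧ qqlt cs t (w, v, u)}.ncard = 2 := by
  have hl : cs.length w + cs.length u = cs.length v + 1 := by omega
  have hl' : cs.length w⁻¹ + cs.length u = cs.length v + 1 := by rwa [cs.length_inv]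
  have hl'' : cs.length u⁻¹ + cs.length w = cs.length v⁻¹ + 1 := by
    rw [cs.length_inv, cs.length_inv, add_comm, hl]
  have hne : w * v ≠ u := by
    rintro rfl
    have := cs.length_mul_mod_two w v
    omega
  have hne1 : u * v⁻¹ ≠ w := fun he => hne (by rw [← he]; simp)
  have hAinv : bruhatLE cs (v * u⁻¹) w⁻¹ ↔ bruhatLE cs (u * v⁻¹) w := by
    rw [← bruhatLE_inv_iff]
    simp
  have hBinv : bruhatLE cs (v⁻¹ * w⁻¹) u⁻¹ ↔ bruhatLE cs (w * v) u := by
    rw [← bruhatLE_inv_iff]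
    simp
  have hCinv : bruhatLE cs v⁻¹ (u⁻¹ * w) ↔ bruhatLE cs v (w⁻¹ * u) := by
    rw [← bruhatLE_inv_iff]
    simp
  have hAB := bruhatLE_or_bruhatLE_of_Qmem cs h hl
  have hABC := fun hC hA => not_bruhatLE_and_bruhatLE cs hl' hC (hAinv.2 hA)
  have hAnC := fun hA hC => bruhatLE_of_not_bruhatLE_mul cs hl' (hAinv.2 hA) hC
  have hBnC : bruhatLE cs (w * v) u → ¬ bruhatLE cs v (w⁻¹ * u) → bruhatLE cs (u * v⁻¹) w :=
    fun hB hC => by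
      simpa using bruhatLE_of_not_bruhatLE_mul cs (x := u⁻¹) (v := v⁻¹) (u := w)
        hl'' (hBinv.2 hB) (by rwa [hCinv])
  rw [inv_inv] at hABC hAnC
  simp only [Qmem_and_qqlt_iff cs hl]
  rw [Set.ncard_eq_two]
  by_cases hA : bruhatLE cs (u * v⁻¹) w <;> by_cases hB : bruhatLE cs (w * v) u <;>
    by_cases hC : bruhatLE cs v (w⁻¹ * u)
  · exact absurd hB (hABC hC hA)
  · refine ⟨(u * v⁻¹, v, u), (w, v, w * v), by simp [hne1], ?_⟩
    ext t
    simp [hA, hB, hC]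
  · refine ⟨(u * v⁻¹, v, u), (w, w⁻¹ * u, u), by simp [hne1], ?_⟩
    ext t
    simp [hA, hB, hC]
  · exact absurd (hAnC hA hC) hB
  · refine ⟨(w, v, w * v), (w, w⁻¹ * u, u), by simp [hne], ?_⟩
    ext t
    simp [hA, hB, hC]
  · exact absurd (hBnC hB hC) hA
  · tauto
  · tauto

end TwistedTP
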